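/- For every k ∈ [0, 1], the function x ↦ arcsin(k · sin x) is concave on [0, π/2], and consequently arcsin(k · sin x) ≤ k x for all x ∈ [0, π/2]. -/

import Mathlib

open Real Set

/-- The derivative of `x ↦ arcsin (k sin x)` where `k sin x` stays inside `(-1, 1)`. -/
lemma hasDerivAt_arcsin_mul_sin {k x : ℝ} (h₁ : k * sin x ≠ -1) (h₂ : k * sin x ≠ 1) :
    HasDerivAt (fun x => arcsin (k * sin x)) (k * cos x / √(1 - (k * sin x) ^ 2)) x := by
  have h := (hasDerivAt_arcsin h₁ h₂).comp x ((hasDerivAt_sin x).const_mul k)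
  rwa [one_div_mul_eq_div] at h

lemma mul_sin_mem_Ico {k x : ℝ} (hk : k ∈ Icc (0 : ℝ) 1) (hx : x ∈ Ioo 0 (π / 2)) :
    k * sin x ∈ Ico (0 : ℝ) 1 := by
  have hs : 0 ≤ sin x := sin_nonneg_of_nonneg_of_le_pi hx.1.le (by linarith [hx.2, pi_pos])
  have hc : 0 < cos x := cos_pos_of_mem_Ioo ⟨by linarith [hx.1, pi_pos], hx.2⟩
  have hs1 : sin x < 1 := by nlinarith [sin_sq_add_cos_sq x]
  exact ⟨mul_nonneg hk.1 hs, (mul_le_of_le_one_left hs hk.2).trans_lt hs1⟩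

/-- The derivative of `x ↦ arcsin (k sin x)` is antitone on `(0, π/2)`. -/
lemma antitoneOn_mul_cos_div_sqrt {k : ℝ} (hk : k ∈ Icc (0 : ℝ) 1) :
    AntitoneOn (fun x => k * cos x / √(1 - (k * sin x) ^ 2)) (Ioo 0 (π / 2)) := by
  intro x hx y hy hxy
  have radicand_pos {z : ℝ} (hz : z ∈ Ioo 0 (π / 2)) : 0 < 1 - (k * sin z) ^ 2 := by
    obtain ⟨h0, h1⟩ := mul_sin_mem_Ico hk hz
    nlinarith
  have hcy : 0 ≤ cos y := cos_nonneg_of_mem_Icc ⟨by linarith [hy.1, pi_pos], hy.2.le⟩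
  have hcxy : cos y ≤ cos x :=
    cos_le_cos_of_nonneg_of_le_pi hx.1.le (by linarith [hy.2, pi_pos]) hxy
  have hcx : 0 ≤ cos x := hcy.trans hcxy
  have key : cos y * √(1 - (k * sin x) ^ 2) ≤ cos x * √(1 - (k * sin y) ^ 2) := by
    refine (sq_le_sq₀ (by positivity) (by positivity)).1 ?_
    rw [mul_pow (cos y), mul_pow (cos x), sq_sqrt (radicand_pos hx).le, sq_sqrt (radicand_pos hy).le,
      mul_pow, mul_pow, sin_sq, sin_sq]
    have hk2 : 0 ≤ 1 - k ^ 2 := by nlinarith [hk.1, hk.2]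
    have hc2 : 0 ≤ cos x ^ 2 - cos y ^ 2 := by nlinarith
    linarith [mul_nonneg hk2 hc2]
  change k * cos y / √(1 - (k * sin y) ^ 2) ≤ k * cos x / √(1 - (k * sin x) ^ 2)
  rw [div_le_div_iff₀ (sqrt_pos.2 (radicand_pos hy)) (sqrt_pos.2 (radicand_pos hx)),
    mul_assoc, mul_assoc]
  exact mul_le_mul_of_nonneg_left key hk.1

lemma concaveOn_arcsin_mul_sin {k : ℝ} (hk : k ∈ Icc (0 : ℝ) 1) :
    ConcaveOn ℝ (Icc 0 (π / 2)) (fun x => arcsin (k * sin x)) := by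
  have hderiv : ∀ x ∈ Ioo 0 (π / 2), HasDerivAt (fun x => arcsin (k * sin x))
      (k * cos x / √(1 - (k * sin x) ^ 2)) x := fun x hx => by
    obtain ⟨h0, h1⟩ := mul_sin_mem_Ico hk hx
    exact hasDerivAt_arcsin_mul_sin (by linarith) h1.ne
  apply AntitoneOn.concaveOn_of_deriv (convex_Icc _ _)
  · exact (continuous_arcsin.comp (continuous_const.mul continuous_sin)).continuousOn
  · rw [interior_Icc]
    exact fun x hx => (hderiv x hx).differentiableAt.differentiableWithinAt
  · rw [interior_Icc]
    exact (antitoneOn_mul_cos_div_sqrt hk).congr fun x hx => (hderiv x hx).deriv.symm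

lemma arcsin_mul_sin_le {k x : ℝ} (hk : k ∈ Icc (0 : ℝ) 1) (hx : x ∈ Icc 0 (π / 2)) :
    arcsin (k * sin x) ≤ k * x := by
  have hkx0 : 0 ≤ k * x := mul_nonneg hk.1 hx.1
  have hkx : k * x ≤ π / 2 := (mul_le_of_le_one_left hx.1 hk.2).trans hx.2
  have hsin : k * sin x ≤ sin (k * x) := by
    have h := strictConcaveOn_sin_Icc.concaveOn.2 (x := x) (y := 0)
      ⟨hx.1, by linarith [hx.2, pi_pos]⟩ ⟨le_rfl, pi_pos.le⟩ hk.1 (sub_nonneg.2 hk.2)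
      (add_sub_cancel k 1)
    simpa using h
  calc arcsin (k * sin x) ≤ arcsin (sin (k * x)) := monotone_arcsin hsin
    _ = k * x := arcsin_sin (by linarith [pi_pos]) hkx

/-- For every `k ∈ [0, 1]`, the function `x ↦ arcsin (k sin x)` is concave on `[0, π/2]`,
and consequently `arcsin (k sin x) ≤ k x` for all `x ∈ [0, π/2]`. -/
theorem arcsin_mul_sin_concaveOn_and_le (k : ℝ) (hk : k ∈ Set.Icc (0:ℝ) 1) :
    ConcaveOn ℝ (Set.Icc 0 (π / 2)) (fun x => Real.arcsin (k * Real.sin x)) ∧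
    ∀ x ∈ Set.Icc (0:ℝ) (π / 2), Real.arcsin (k * Real.sin x) ≤ k * x :=
  ⟨concaveOn_arcsin_mul_sin hk, fun _ hx => arcsin_mul_sin_le hk hx⟩
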